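/- Proposition (Poisson property for the weighted case 𝒲ℙ^{3|2}[1,3]): On the supercommutative algebra A = ℂ[z¹, z², λ₁, λ₂] ⊗ Λ(ξ₁, ξ₂), the bracket determined by the superbivector π = λ₁λ₂ ∂/∂z¹ ∧ ∂/∂z² + ½(λ₁² + λ₂²) ∂/∂ξ₁ ∨ ∂/∂ξ₁ + ½(λ₁² + λ₂²)³ ∂/∂ξ₂ ∨ ∂/∂ξ₂ is an even super Poisson bracket: even, super antisymmetric, super Leibniz, and satisfying the super Jacobi identity. -/

import Mathlib

/-!
Weighted case `𝒲ℙ^{3|2}[1,3]`: the superbivector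
`π = λ₁λ₂ ∂_{z¹} ∧ ∂_{z²} + ½(λ₁² + λ₂²) ∂_{ξ₁} ∨ ∂_{ξ₁} + ½(λ₁² + λ₂²)³ ∂_{ξ₂} ∨ ∂_{ξ₂}`
on `A = ℂ[z¹, z², λ₁, λ₂] ⊗ Λ(ξ₁, ξ₂)` determines an even super Poisson bracket.
-/

open scoped TensorProduct

noncomputable section

/-- The supercommutative algebra `A = ℂ[z¹, z², λ₁, λ₂] ⊗ Λ(ξ₁, ξ₂)`. -/
abbrev WAlg := MvPolynomial (Fin 2 ⊕ Fin 2) ℂ ⊗[ℂ] ExteriorAlgebra ℂ (Fin 2 → ℂ)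

/-- The even generator `z^α`. -/
def z (α : Fin 2) : WAlg := MvPolynomial.X (Sum.inl α) ⊗ₜ 1

/-- The even generator `λ_α̇`. -/
def lam (α : Fin 2) : WAlg := MvPolynomial.X (Sum.inr α) ⊗ₜ 1

/-- The odd generator `ξᵢ`. -/
def xi (i : Fin 2) : WAlg := 1 ⊗ₜ ExteriorAlgebra.ι ℂ (Pi.single i 1)

/-- The even derivation `∂/∂z^α`. -/
def Dz (α : Fin 2) : WAlg →ₗ[ℂ] WAlg :=
  TensorProduct.map (MvPolynomial.pderiv (Sum.inl α)).toLinearMap LinearMap.id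

/-- The (left) odd derivation `∂/∂ξᵢ`. -/
def Dxi (i : Fin 2) : WAlg →ₗ[ℂ] WAlg :=
  TensorProduct.map LinearMap.id (CliffordAlgebra.contractLeft (LinearMap.proj i))

/-- The grade involution of `A`. -/
def alphaA : WAlg →ₗ[ℂ] WAlg :=
  TensorProduct.map LinearMap.id (CliffordAlgebra.involute (Q := 0)).toLinearMap

/-- `f` is homogeneous of Grassmann parity `p`. -/
def IsHomog (p : ZMod 2) (f : WAlg) : Prop :=
  alphaA f = if p = 0 then f else -f

/-- The sign `(-1)^p` for `p : ZMod 2`. -/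
def sgn (p : ZMod 2) : ℂ := if p = 0 then 1 else -1

/-- `λ₁λ₂`. -/
def lamlam : WAlg := lam 0 * lam 1

/-- `λ₁² + λ₂²`. -/
def lamSq : WAlg := lam 0 * lam 0 + lam 1 * lam 1

/-- The bracket determined by the superbivector `π` (with coefficients
`π^{z¹z²} = −π^{z²z¹} = λ₁λ₂`, `π^{ξ₁ξ₁} = λ₁² + λ₂²`, `π^{ξ₂ξ₂} = (λ₁² + λ₂²)³`) on
elements `f` of parity `p`, with Koszul signs. -/
def br (p : ZMod 2) (f g : WAlg) : WAlg :=
  lamlam * (Dz 0 f * Dz 1 g - Dz 1 f * Dz 0 g) +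
    sgn p • (lamSq * (Dxi 0 f * Dxi 0 g) + lamSq ^ 3 * (Dxi 1 f * Dxi 1 g))

/-- The element `a + b ξ₁ + c ξ₂ + d ξ₁ξ₂` of `A` with polynomial components `a, b, c, d`. -/
def ofComponents (a b c d : MvPolynomial (Fin 2 ⊕ Fin 2) ℂ) : WAlg :=
  a ⊗ₜ 1 + b ⊗ₜ ExteriorAlgebra.ι ℂ (Pi.single 0 1) + c ⊗ₜ ExteriorAlgebra.ι ℂ (Pi.single 1 1) +
    d ⊗ₜ (ExteriorAlgebra.ι ℂ (Pi.single 0 1) * ExteriorAlgebra.ι ℂ (Pi.single 1 1))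

lemma ofComponents_congr {a b c d a' b' c' d' : MvPolynomial (Fin 2 ⊕ Fin 2) ℂ} (ha : a = a')
    (hb : b = b') (hc : c = c') (hd : d = d') :
    ofComponents a b c d = ofComponents a' b' c' d' := by
  rw [ha, hb, hc, hd]

section ofComponents

variable (a b c d a' b' c' d' : MvPolynomial (Fin 2 ⊕ Fin 2) ℂ)

lemma ofComponents_zero : ofComponents 0 0 0 0 = 0 := by
  simp [ofComponents]

lemma ofComponents_add : ofComponents a b c d + ofComponents a' b' c' d' =
    ofComponents (a + a') (b + b') (c + c') (d + d') := by
  simp only [ofComponents, TensorProduct.add_tmul]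
  abel

lemma ofComponents_neg : -ofComponents a b c d = ofComponents (-a) (-b) (-c) (-d) := by
  simp only [ofComponents, TensorProduct.neg_tmul]
  abel

lemma ofComponents_sub : ofComponents a b c d - ofComponents a' b' c' d' =
    ofComponents (a - a') (b - b') (c - c') (d - d') := by
  simp only [sub_eq_add_neg, ofComponents_neg, ofComponents_add]

lemma smul_ofComponents (t : ℂ) :
    t • ofComponents a b c d = ofComponents (t • a) (t • b) (t • c) (t • d) := by
  simp only [ofComponents, smul_add, TensorProduct.smul_tmul']

lemma ofComponents_mul : ofComponents a b c d * ofComponents a' b' c' d' =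
    ofComponents (a * a') (a * b' + b * a') (a * c' + c * a')
      (a * d' + b * c' - c * b' + d * a') := by
  have h0 := ExteriorAlgebra.ι_sq_zero (R := ℂ) (Pi.single 0 1 : Fin 2 → ℂ)
  have h1 := ExteriorAlgebra.ι_sq_zero (R := ℂ) (Pi.single 1 1 : Fin 2 → ℂ)
  have h10 : ExteriorAlgebra.ι ℂ (Pi.single 1 1 : Fin 2 → ℂ) *
      ExteriorAlgebra.ι ℂ (Pi.single 0 1) =
      -(ExteriorAlgebra.ι ℂ (Pi.single 0 1) * ExteriorAlgebra.ι ℂ (Pi.single 1 1)) :=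
    eq_neg_of_add_eq_zero_left (ExteriorAlgebra.ι_add_mul_swap _ _)
  simp only [ofComponents]
  generalize ExteriorAlgebra.ι ℂ (Pi.single 0 1 : Fin 2 → ℂ) = x at *
  generalize ExteriorAlgebra.ι ℂ (Pi.single 1 1 : Fin 2 → ℂ) = y at *
  have e1 : x * (x * y) = 0 := by rw [← mul_assoc, h0, zero_mul]
  have e2 : y * (x * y) = 0 := by rw [← mul_assoc, h10, neg_mul, mul_assoc, h1, mul_zero, neg_zero]
  have e3 : x * y * x = 0 := by rw [mul_assoc, h10, mul_neg, e1, neg_zero]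
  have e4 : x * y * y = 0 := by rw [mul_assoc, h1, mul_zero]
  have e5 : x * y * (x * y) = 0 := by rw [mul_assoc, e2, mul_zero]
  simp only [add_mul, mul_add, Algebra.TensorProduct.tmul_mul_tmul, h0, h1, h10, e1, e2, e3, e4,
    e5, one_mul, mul_one, TensorProduct.tmul_zero, TensorProduct.tmul_neg, TensorProduct.add_tmul,
    TensorProduct.sub_tmul]
  abel

lemma Dz_ofComponents (α : Fin 2) : Dz α (ofComponents a b c d) =
    ofComponents (MvPolynomial.pderiv (Sum.inl α) a) (MvPolynomial.pderiv (Sum.inl α) b)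
      (MvPolynomial.pderiv (Sum.inl α) c) (MvPolynomial.pderiv (Sum.inl α) d) := by
  simp [Dz, ofComponents]

lemma Dxi_zero_ofComponents : Dxi 0 (ofComponents a b c d) = ofComponents b 0 d 0 := by
  simp only [Dxi, ofComponents, map_add, TensorProduct.map_tmul, LinearMap.id_apply,
    ExteriorAlgebra.ι]
  simp [CliffordAlgebra.contractLeft_ι_mul, CliffordAlgebra.contractLeft_ι]

lemma Dxi_one_ofComponents : Dxi 1 (ofComponents a b c d) = ofComponents c (-d) 0 0 := by
  simp only [Dxi, ofComponents, map_add, TensorProduct.map_tmul, LinearMap.id_apply,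
    ExteriorAlgebra.ι]
  simp [CliffordAlgebra.contractLeft_ι_mul, CliffordAlgebra.contractLeft_ι,
    TensorProduct.tmul_neg, TensorProduct.neg_tmul]

lemma alphaA_ofComponents : alphaA (ofComponents a b c d) = ofComponents a (-b) (-c) d := by
  simp only [alphaA, ofComponents, map_add, TensorProduct.map_tmul, LinearMap.id_apply,
    ExteriorAlgebra.ι]
  simp [TensorProduct.tmul_neg, TensorProduct.neg_tmul]

end ofComponents

lemma exists_ofComponents (f : WAlg) : ∃ a b c d, f = ofComponents a b c d := by
  induction f using TensorProduct.induction_on with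
  | zero => exact ⟨0, 0, 0, 0, ofComponents_zero.symm⟩
  | add f g hf hg =>
    obtain ⟨a, b, c, d, rfl⟩ := hf
    obtain ⟨a', b', c', d', rfl⟩ := hg
    exact ⟨_, _, _, _, ofComponents_add ..⟩
  | tmul p x =>
    have key : ∃ a b c d, (1 : MvPolynomial (Fin 2 ⊕ Fin 2) ℂ) ⊗ₜ[ℂ] x =
        ofComponents a b c d := by
      induction x using ExteriorAlgebra.induction with
      | algebraMap r =>
        refine ⟨MvPolynomial.C r, 0, 0, 0, ?_⟩
        simp [ofComponents, Algebra.algebraMap_eq_smul_one, MvPolynomial.C_eq_smul_one,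
          TensorProduct.smul_tmul]
      | ι v =>
        refine ⟨0, MvPolynomial.C (v 0), MvPolynomial.C (v 1), 0, ?_⟩
        have hv : v = v 0 • Pi.single 0 1 + v 1 • Pi.single 1 1 := by
          ext i
          fin_cases i <;> simp
        conv_lhs => rw [hv]
        simp [ofComponents, MvPolynomial.C_eq_smul_one, TensorProduct.tmul_add,
          TensorProduct.smul_tmul]
      | mul x y hx hy =>
        obtain ⟨a, b, c, d, hx⟩ := hx
        obtain ⟨a', b', c', d', hy⟩ := hy
        exact ⟨_, _, _, _, by
          rw [← one_mul (1 : MvPolynomial (Fin 2 ⊕ Fin 2) ℂ),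
            ← Algebra.TensorProduct.tmul_mul_tmul, hx, hy, ofComponents_mul]⟩
      | add x y hx hy =>
        obtain ⟨a, b, c, d, hx⟩ := hx
        obtain ⟨a', b', c', d', hy⟩ := hy
        exact ⟨_, _, _, _, by rw [TensorProduct.tmul_add, hx, hy, ofComponents_add]⟩
    obtain ⟨a, b, c, d, h⟩ := key
    have hp : p ⊗ₜ[ℂ] x = ofComponents p 0 0 0 * (1 ⊗ₜ x) := by
      simp [ofComponents]
    exact ⟨_, _, _, _, by rw [hp, h, ofComponents_mul]⟩

lemma exists_ofComponents_of_isHomog_zero {f : WAlg} (hf : IsHomog 0 f) :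
    ∃ a d, f = ofComponents a 0 0 d := by
  obtain ⟨a, b, c, d, rfl⟩ := exists_ofComponents f
  have hf : alphaA _ = _ := hf
  rw [if_pos rfl] at hf
  refine ⟨a, d, ?_⟩
  calc ofComponents a b c d
      = (2⁻¹ : ℂ) • (alphaA (ofComponents a b c d) + ofComponents a b c d) := by
        rw [hf, ← two_smul ℂ, inv_smul_smul₀ two_ne_zero]
    _ = ofComponents a 0 0 d := by
        rw [alphaA_ofComponents, ofComponents_add, ← two_smul ℂ a, ← two_smul ℂ d,
          smul_ofComponents, inv_smul_smul₀ two_ne_zero, inv_smul_smul₀ two_ne_zero]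
        simp

lemma exists_ofComponents_of_isHomog_one {f : WAlg} (hf : IsHomog 1 f) :
    ∃ b c, f = ofComponents 0 b c 0 := by
  obtain ⟨a, b, c, d, rfl⟩ := exists_ofComponents f
  have hf : alphaA _ = _ := hf
  rw [if_neg one_ne_zero] at hf
  refine ⟨b, c, ?_⟩
  calc ofComponents a b c d
      = (2⁻¹ : ℂ) • (ofComponents a b c d - alphaA (ofComponents a b c d)) := by
        rw [hf, sub_neg_eq_add, ← two_smul ℂ, inv_smul_smul₀ two_ne_zero]
    _ = ofComponents 0 b c 0 := by
        rw [alphaA_ofComponents, ofComponents_sub, sub_neg_eq_add, sub_neg_eq_add,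
          ← two_smul ℂ b, ← two_smul ℂ c,
          smul_ofComponents, inv_smul_smul₀ two_ne_zero, inv_smul_smul₀ two_ne_zero]
        simp

lemma exists_lamlam_eq : ∃ w, lamlam = ofComponents w 0 0 0 ∧
    ∀ α, MvPolynomial.pderiv (Sum.inl α) w = 0 :=
  ⟨MvPolynomial.X (Sum.inr 0) * MvPolynomial.X (Sum.inr 1),
    by simp [lamlam, lam, ofComponents],
    fun α => by simp [MvPolynomial.pderiv_X]⟩

lemma exists_lamSq_eq : ∃ s, lamSq = ofComponents s 0 0 0 ∧
    ∀ α, MvPolynomial.pderiv (Sum.inl α) s = 0 :=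
  ⟨MvPolynomial.X (Sum.inr 0) * MvPolynomial.X (Sum.inr 0) +
      MvPolynomial.X (Sum.inr 1) * MvPolynomial.X (Sum.inr 1),
    by simp [lamSq, lam, ofComponents, TensorProduct.add_tmul],
    fun α => by simp [MvPolynomial.pderiv_X]⟩

lemma sgn_zero : sgn 0 = 1 := if_pos rfl

lemma sgn_one : sgn 1 = -1 := if_neg one_ne_zero

lemma pderiv_pderiv_comm {σ R : Type*} [CommRing R] (i j : σ) (a : MvPolynomial σ R) :
    MvPolynomial.pderiv i (MvPolynomial.pderiv j a) =
      MvPolynomial.pderiv j (MvPolynomial.pderiv i a) := by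
  classical
  have h : ⁅MvPolynomial.pderiv (R := R) i, MvPolynomial.pderiv j⁆ = 0 :=
    MvPolynomial.derivation_ext fun k => by
      rw [Derivation.commutator_apply]
      simp [MvPolynomial.pderiv_X, Pi.single_apply, apply_ite]
  rw [← sub_eq_zero, ← Derivation.commutator_apply, h, Derivation.zero_apply]

/-- The Poisson bracket `∂₁a ∂₂b - ∂₂a ∂₁b` on polynomials, with respect to `z¹, z²`. -/
def polyBracket (a b : MvPolynomial (Fin 2 ⊕ Fin 2) ℂ) : MvPolynomial (Fin 2 ⊕ Fin 2) ℂ :=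
  MvPolynomial.pderiv (Sum.inl 0) a * MvPolynomial.pderiv (Sum.inl 1) b -
    MvPolynomial.pderiv (Sum.inl 1) a * MvPolynomial.pderiv (Sum.inl 0) b

lemma br_even_even {w s : MvPolynomial (Fin 2 ⊕ Fin 2) ℂ} (hw : lamlam = ofComponents w 0 0 0)
    (hs : lamSq = ofComponents s 0 0 0) (a d a' d' : MvPolynomial (Fin 2 ⊕ Fin 2) ℂ) :
    br 0 (ofComponents a 0 0 d) (ofComponents a' 0 0 d') =
      ofComponents (w * polyBracket a a') 0 0 (w * (polyBracket a d' + polyBracket d a')) := by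
  simp only [br, hw, hs, pow_succ, pow_zero, one_mul, sgn_zero, Dz_ofComponents,
    Dxi_zero_ofComponents, Dxi_one_ofComponents, ofComponents_mul, ofComponents_add,
    ofComponents_sub, polyBracket, map_zero, one_smul]
  refine ofComponents_congr ?_ ?_ ?_ ?_ <;> ring

lemma br_even_odd {w s : MvPolynomial (Fin 2 ⊕ Fin 2) ℂ} (hw : lamlam = ofComponents w 0 0 0)
    (hs : lamSq = ofComponents s 0 0 0) (a d b' c' : MvPolynomial (Fin 2 ⊕ Fin 2) ℂ) :
    br 0 (ofComponents a 0 0 d) (ofComponents 0 b' c' 0) =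
      ofComponents 0 (w * polyBracket a b' - s ^ 3 * (d * c'))
        (w * polyBracket a c' + s * (d * b')) 0 := by
  simp only [br, hw, hs, pow_succ, pow_zero, one_mul, sgn_zero, Dz_ofComponents,
    Dxi_zero_ofComponents, Dxi_one_ofComponents, ofComponents_mul, ofComponents_add,
    ofComponents_sub, polyBracket, map_zero, one_smul]
  refine ofComponents_congr ?_ ?_ ?_ ?_ <;> ring

lemma br_odd_even {w s : MvPolynomial (Fin 2 ⊕ Fin 2) ℂ} (hw : lamlam = ofComponents w 0 0 0)
    (hs : lamSq = ofComponents s 0 0 0) (b c a' d' : MvPolynomial (Fin 2 ⊕ Fin 2) ℂ) :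
    br 1 (ofComponents 0 b c 0) (ofComponents a' 0 0 d') =
      ofComponents 0 (w * polyBracket b a' + s ^ 3 * (c * d'))
        (w * polyBracket c a' - s * (b * d')) 0 := by
  simp only [br, hw, hs, pow_succ, pow_zero, one_mul, sgn_one, Dz_ofComponents,
    Dxi_zero_ofComponents, Dxi_one_ofComponents, ofComponents_mul, ofComponents_add,
    ofComponents_sub, smul_ofComponents, polyBracket, map_zero, one_smul, neg_smul]
  refine ofComponents_congr ?_ ?_ ?_ ?_ <;> ring

lemma br_odd_odd {w s : MvPolynomial (Fin 2 ⊕ Fin 2) ℂ} (hw : lamlam = ofComponents w 0 0 0)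
    (hs : lamSq = ofComponents s 0 0 0) (b c b' c' : MvPolynomial (Fin 2 ⊕ Fin 2) ℂ) :
    br 1 (ofComponents 0 b c 0) (ofComponents 0 b' c' 0) =
      ofComponents (-(s * (b * b') + s ^ 3 * (c * c'))) 0 0
        (w * (polyBracket b c' - polyBracket c b')) := by
  simp only [br, hw, hs, pow_succ, pow_zero, one_mul, sgn_one, Dz_ofComponents,
    Dxi_zero_ofComponents, Dxi_one_ofComponents, ofComponents_mul, ofComponents_add,
    ofComponents_sub, smul_ofComponents, polyBracket, map_zero, one_smul, neg_smul]
  refine ofComponents_congr ?_ ?_ ?_ ?_ <;> ring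

lemma isHomog_zero_ofComponents (a d : MvPolynomial (Fin 2 ⊕ Fin 2) ℂ) :
    IsHomog 0 (ofComponents a 0 0 d) := by
  rw [IsHomog, if_pos rfl, alphaA_ofComponents, neg_zero]

lemma isHomog_one_ofComponents (b c : MvPolynomial (Fin 2 ⊕ Fin 2) ℂ) :
    IsHomog 1 (ofComponents 0 b c 0) := by
  rw [IsHomog, if_neg one_ne_zero, alphaA_ofComponents, ofComponents_neg, neg_zero]

lemma exists_ofComponents_of_isHomog {p : ZMod 2} {f : WAlg} (hf : IsHomog p f) :
    (p = 0 ∧ ∃ a d, f = ofComponents a 0 0 d) ∨ (p = 1 ∧ ∃ b c, f = ofComponents 0 b c 0) := by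
  obtain rfl | rfl : p = 0 ∨ p = 1 := (by decide : ∀ p : ZMod 2, p = 0 ∨ p = 1) p
  · exact .inl ⟨rfl, exists_ofComponents_of_isHomog_zero hf⟩
  · exact .inr ⟨rfl, exists_ofComponents_of_isHomog_one hf⟩

lemma br_mul {p q : ZMod 2} {f g : WAlg} (hf : IsHomog p f) (hg : IsHomog q g) (h : WAlg) :
    br p f (g * h) = br p f g * h + sgn (p * q) • (g * br p f h) := by
  obtain ⟨w, hw, -⟩ := exists_lamlam_eq
  obtain ⟨s, hs, -⟩ := exists_lamSq_eq
  obtain ⟨x, y, u, v, rfl⟩ := exists_ofComponents h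
  rcases exists_ofComponents_of_isHomog hf with ⟨rfl, a, d, rfl⟩ | ⟨rfl, a, d, rfl⟩ <;>
  rcases exists_ofComponents_of_isHomog hg with ⟨rfl, a', d', rfl⟩ | ⟨rfl, a', d', rfl⟩ <;>
  simp only [br, hw, hs, pow_succ, pow_zero, one_mul, sgn_zero, sgn_one, Dz_ofComponents,
    Dxi_zero_ofComponents, Dxi_one_ofComponents, ofComponents_mul, ofComponents_add,
    ofComponents_sub, smul_ofComponents, map_zero, mul_zero, mul_one, one_smul, neg_smul,
    map_add, map_sub, Derivation.leibniz, smul_eq_mul] <;>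
  refine ofComponents_congr ?_ ?_ ?_ ?_ <;> ring

lemma br_jacobi_even_even_even
    (a₁ d₁ a₂ d₂ a₃ d₃ : MvPolynomial (Fin 2 ⊕ Fin 2) ℂ) :
    sgn (0 * 0) • br 0 (ofComponents a₁ 0 0 d₁)
        (br 0 (ofComponents a₂ 0 0 d₂) (ofComponents a₃ 0 0 d₃)) +
      sgn (0 * 0) • br 0 (ofComponents a₂ 0 0 d₂)
        (br 0 (ofComponents a₃ 0 0 d₃) (ofComponents a₁ 0 0 d₁)) +
      sgn (0 * 0) • br 0 (ofComponents a₃ 0 0 d₃)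
        (br 0 (ofComponents a₁ 0 0 d₁) (ofComponents a₂ 0 0 d₂)) = 0 := by
  obtain ⟨w, hw, hw'⟩ := exists_lamlam_eq
  obtain ⟨s, hs, -⟩ := exists_lamSq_eq
  simp only [br_even_even hw hs, mul_zero, sgn_zero, smul_ofComponents, ofComponents_add,
    ← ofComponents_zero, polyBracket]
  refine ofComponents_congr ?_ ?_ ?_ ?_ <;>
  simp only [map_add, map_sub, Derivation.leibniz, smul_eq_mul, smul_zero, hw',
    pderiv_pderiv_comm (Sum.inl (1 : Fin 2) : Fin 2 ⊕ Fin 2) (Sum.inl 0), one_smul] <;>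
  ring

lemma br_jacobi_even_even_odd
    (a₁ d₁ a₂ d₂ b₃ c₃ : MvPolynomial (Fin 2 ⊕ Fin 2) ℂ) :
    sgn (0 * 1) • br 0 (ofComponents a₁ 0 0 d₁)
        (br 0 (ofComponents a₂ 0 0 d₂) (ofComponents 0 b₃ c₃ 0)) +
      sgn (0 * 0) • br 0 (ofComponents a₂ 0 0 d₂)
        (br 1 (ofComponents 0 b₃ c₃ 0) (ofComponents a₁ 0 0 d₁)) +
      sgn (1 * 0) • br 1 (ofComponents 0 b₃ c₃ 0)
        (br 0 (ofComponents a₁ 0 0 d₁) (ofComponents a₂ 0 0 d₂)) = 0 := by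
  obtain ⟨w, hw, hw'⟩ := exists_lamlam_eq
  obtain ⟨s, hs, hs'⟩ := exists_lamSq_eq
  simp only [br_even_even hw hs, br_even_odd hw hs, br_odd_even hw hs, mul_zero, mul_one,
    sgn_zero, smul_ofComponents, ofComponents_add, ← ofComponents_zero, polyBracket]
  refine ofComponents_congr ?_ ?_ ?_ ?_ <;>
  simp only [map_add, map_sub, Derivation.leibniz, Derivation.leibniz_pow, smul_eq_mul,
    smul_zero, hw', hs', pderiv_pderiv_comm (Sum.inl (1 : Fin 2) : Fin 2 ⊕ Fin 2) (Sum.inl 0),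
    one_smul] <;>
  ring

lemma br_jacobi_even_odd_odd
    (a₁ d₁ b₂ c₂ b₃ c₃ : MvPolynomial (Fin 2 ⊕ Fin 2) ℂ) :
    sgn (0 * 1) • br 0 (ofComponents a₁ 0 0 d₁)
        (br 1 (ofComponents 0 b₂ c₂ 0) (ofComponents 0 b₃ c₃ 0)) +
      sgn (1 * 0) • br 1 (ofComponents 0 b₂ c₂ 0)
        (br 1 (ofComponents 0 b₃ c₃ 0) (ofComponents a₁ 0 0 d₁)) +
      sgn (1 * 1) • br 1 (ofComponents 0 b₃ c₃ 0)
        (br 0 (ofComponents a₁ 0 0 d₁) (ofComponents 0 b₂ c₂ 0)) = 0 := by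
  obtain ⟨w, hw, hw'⟩ := exists_lamlam_eq
  obtain ⟨s, hs, hs'⟩ := exists_lamSq_eq
  simp only [br_even_even hw hs, br_even_odd hw hs, br_odd_even hw hs, br_odd_odd hw hs,
    mul_zero, mul_one, sgn_zero, sgn_one, smul_ofComponents, ofComponents_add,
    ← ofComponents_zero, polyBracket]
  refine ofComponents_congr ?_ ?_ ?_ ?_ <;>
  simp only [map_add, map_sub, map_neg, Derivation.leibniz, Derivation.leibniz_pow, smul_eq_mul,
    smul_zero, hw', hs', pderiv_pderiv_comm (Sum.inl (1 : Fin 2) : Fin 2 ⊕ Fin 2) (Sum.inl 0),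
    neg_smul, one_smul] <;>
  ring

lemma br_jacobi_odd_odd_odd
    (b₁ c₁ b₂ c₂ b₃ c₃ : MvPolynomial (Fin 2 ⊕ Fin 2) ℂ) :
    sgn (1 * 1) • br 1 (ofComponents 0 b₁ c₁ 0)
        (br 1 (ofComponents 0 b₂ c₂ 0) (ofComponents 0 b₃ c₃ 0)) +
      sgn (1 * 1) • br 1 (ofComponents 0 b₂ c₂ 0)
        (br 1 (ofComponents 0 b₃ c₃ 0) (ofComponents 0 b₁ c₁ 0)) +
      sgn (1 * 1) • br 1 (ofComponents 0 b₃ c₃ 0)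
        (br 1 (ofComponents 0 b₁ c₁ 0) (ofComponents 0 b₂ c₂ 0)) = 0 := by
  obtain ⟨w, hw, -⟩ := exists_lamlam_eq
  obtain ⟨s, hs, hs'⟩ := exists_lamSq_eq
  simp only [br_odd_even hw hs, br_odd_odd hw hs, mul_one, sgn_one, smul_ofComponents,
    ofComponents_add, ← ofComponents_zero, polyBracket]
  refine ofComponents_congr ?_ ?_ ?_ ?_ <;>
  simp only [map_add, map_neg, Derivation.leibniz, Derivation.leibniz_pow, smul_eq_mul,
    smul_zero, hs', neg_smul, one_smul] <;>
  ring

/-- The bracket determined by the superbivector `π` of the weighted case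
`𝒲ℙ^{3|2}[1,3]` is an even super Poisson bracket: even, super antisymmetric, super
Leibniz, and satisfying the super Jacobi identity. -/
theorem br_superPoisson_WP13 :
    (∀ (p q : ZMod 2) (f g : WAlg), IsHomog p f → IsHomog q g →
      IsHomog (p + q) (br p f g)) ∧
    (∀ (p q : ZMod 2) (f g : WAlg), IsHomog p f → IsHomog q g →
      br p f g = -(sgn (p * q)) • br q g f) ∧
    (∀ (p q : ZMod 2) (f g h : WAlg), IsHomog p f → IsHomog q g →
      br p f (g * h) = br p f g * h + sgn (p * q) • (g * br p f h)) ∧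
    (∀ (p q r : ZMod 2) (f g h : WAlg), IsHomog p f → IsHomog q g → IsHomog r h →
      sgn (p * r) • br p f (br q g h) + sgn (q * p) • br q g (br r h f) +
        sgn (r * q) • br r h (br p f g) = 0) := by
  obtain ⟨w, hw, -⟩ := exists_lamlam_eq
  obtain ⟨s, hs, -⟩ := exists_lamSq_eq
  have h2 : (1 + 1 : ZMod 2) = 0 := rfl
  refine ⟨fun p q f g hf hg => ?_, fun p q f g hf hg => ?_, fun p q f g h hf hg => ?_,
    fun p q r f g h hf hg hh => ?_⟩
  · rcases exists_ofComponents_of_isHomog hf with ⟨rfl, a, d, rfl⟩ | ⟨rfl, a, d, rfl⟩ <;>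
    rcases exists_ofComponents_of_isHomog hg with ⟨rfl, a', d', rfl⟩ | ⟨rfl, a', d', rfl⟩ <;>
    simp only [br_even_even hw hs, br_even_odd hw hs, br_odd_even hw hs, br_odd_odd hw hs,
      add_zero, zero_add, h2, isHomog_zero_ofComponents, isHomog_one_ofComponents]
  · rcases exists_ofComponents_of_isHomog hf with ⟨rfl, a, d, rfl⟩ | ⟨rfl, a, d, rfl⟩ <;>
    rcases exists_ofComponents_of_isHomog hg with ⟨rfl, a', d', rfl⟩ | ⟨rfl, a', d', rfl⟩ <;>
    simp only [br_even_even hw hs, br_even_odd hw hs, br_odd_even hw hs, br_odd_odd hw hs,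
      mul_zero, mul_one, sgn_zero, sgn_one, smul_ofComponents, polyBracket, one_smul, neg_smul,
      neg_neg] <;>
    refine ofComponents_congr ?_ ?_ ?_ ?_ <;> ring
  · exact br_mul hf hg h
  · rcases exists_ofComponents_of_isHomog hf with ⟨rfl, a₁, d₁, rfl⟩ | ⟨rfl, a₁, d₁, rfl⟩ <;>
    rcases exists_ofComponents_of_isHomog hg with ⟨rfl, a₂, d₂, rfl⟩ | ⟨rfl, a₂, d₂, rfl⟩ <;>
    rcases exists_ofComponents_of_isHomog hh with ⟨rfl, a₃, d₃, rfl⟩ | ⟨rfl, a₃, d₃, rfl⟩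
    · exact br_jacobi_even_even_even ..
    · exact br_jacobi_even_even_odd ..
    · exact (add_rotate _ _ _).trans ((add_rotate _ _ _).trans
        (br_jacobi_even_even_odd a₃ d₃ a₁ d₁ a₂ d₂))
    · exact br_jacobi_even_odd_odd ..
    · exact (add_rotate _ _ _).trans (br_jacobi_even_even_odd a₂ d₂ a₃ d₃ a₁ d₁)
    · exact (add_rotate _ _ _).trans (br_jacobi_even_odd_odd a₂ d₂ a₃ d₃ a₁ d₁)
    · exact (add_rotate _ _ _).trans ((add_rotate _ _ _).trans
        (br_jacobi_even_odd_odd a₃ d₃ a₁ d₁ a₂ d₂))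
    · exact br_jacobi_odd_odd_odd ..

end
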